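/- Let n be a natural number, c : Fin n → ℝ with c_l > 0 for every l, and h : Fin n → ℝ with h_l ≥ 0 for every l. Define f(d) = sSup { Σ_l h_l·γ_l : γ ∈ ℝ^n, 0 ≤ γ_l ≤ 1 for all l, Σ_l c_l·γ_l = d }. Then f is monotone nondecreasing on [0, Σ_l c_l]: for all d¹, d² with 0 ≤ d¹ ≤ d² ≤ Σ_l c_l, one has f(d¹) ≤ f(d²). -/

import Mathlib

/-- With nonnegative per-section CO₂ savings `h l ≥ 0`, the utility function
`f` is monotone nondecreasing on `[0, ∑ l, c l]`. -/
theorem utility_monotone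
    (n : ℕ) (c h : Fin n → ℝ) (hc : ∀ l, 0 < c l) (hh : ∀ l, 0 ≤ h l)
    (f : ℝ → ℝ)
    (hf : ∀ d : ℝ, f d =
      sSup { x : ℝ | ∃ γ : Fin n → ℝ,
        (∀ l, 0 ≤ γ l ∧ γ l ≤ 1) ∧
        (∑ l, c l * γ l) = d ∧
        x = ∑ l, h l * γ l }) :
    ∀ d₁ d₂ : ℝ, 0 ≤ d₁ → d₁ ≤ d₂ → d₂ ≤ ∑ l, c l → f d₁ ≤ f d₂ := by
  intro d₁ d₂ _ h12 h2
  rw [hf d₁, hf d₂]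
  refine Real.sSup_le ?_ (Real.sSup_nonneg ?_)
  · rintro x ⟨γ, hγ, hd, rfl⟩
    obtain ⟨t, ht0, ht1, ht⟩ : ∃ t : ℝ, 0 ≤ t ∧ t ≤ 1 ∧ t * (∑ l, c l - d₁) = d₂ - d₁ := by
      rcases (h12.trans h2).eq_or_lt with heq | hlt
      · exact ⟨0, le_rfl, zero_le_one, by linarith⟩
      · have hpos : 0 < ∑ l, c l - d₁ := sub_pos.2 hlt
        exact ⟨(d₂ - d₁) / (∑ l, c l - d₁), div_nonneg (sub_nonneg.2 h12) hpos.le,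
          (div_le_one hpos).2 (by linarith), div_mul_cancel₀ _ hpos.ne'⟩
    have hle : ∀ l, γ l ≤ γ l + t * (1 - γ l) := fun l =>
      le_add_of_nonneg_right (mul_nonneg ht0 (sub_nonneg.2 (hγ l).2))
    refine le_trans (Finset.sum_le_sum fun l _ => mul_le_mul_of_nonneg_left (hle l) (hh l))
      (le_csSup ⟨∑ l, h l, ?_⟩ ⟨fun l => γ l + t * (1 - γ l), fun l => ⟨?_, ?_⟩, ?_, rfl⟩)
    · rintro y ⟨δ, hδ, -, rfl⟩
      exact Finset.sum_le_sum fun l _ => mul_le_of_le_one_right (hh l) (hδ l).2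
    · exact (hγ l).1.trans (hle l)
    · nlinarith [(hγ l).2]
    · have hsum : ∑ l, c l * (γ l + t * (1 - γ l)) =
          ∑ l, c l * γ l + t * (∑ l, c l - ∑ l, c l * γ l) := by
        rw [← Finset.sum_sub_distrib, Finset.mul_sum, ← Finset.sum_add_distrib]
        exact Finset.sum_congr rfl fun l _ => by ring
      rw [hsum, hd, ht]
      ring
  · rintro x ⟨γ, hγ, -, rfl⟩
    exact Finset.sum_nonneg fun l _ => mul_nonneg (hh l) (hγ l).1
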